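/- (Theorem 1, existence.) Let F be a totally symmetric quadrilinear form on ℝ³ (F(x₁,x₂,x₃,x₄) invariant under all permutations of its arguments), let ν = e₃, and let ℛ(ν) = {τ ∈ ℝ³ : ‖τ‖ = 1, τ·ν = 0} ∪ {ν}. Then there exist a scalar ω_m ∈ ℝ, a traceless symmetric 3×3 matrix ω′ with ω′ν parallel to ν (equivalently ω′₁₃ = ω′₂₃ = 0), and a traceless symmetric 3×3 matrix h with hν = 0, such that for every n ∈ ℛ(ν): F(n,n,n,n) = ω_m + nᵀω′n + (nᵀh n)² − (4/7)‖n‖² nᵀh²n + (2/35)tr(h²)‖n‖⁴. -/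

import Mathlib

open Matrix

/-- The out-of-plane direction `ν = e₃`. -/
def nu3 : Fin 3 → ℝ := ![0, 0, 1]

/-- The quartic form of the harmonic square `h ∗ h` evaluated at `n`, plus the lower order
terms `ω_m + nᵀω′n`. -/
noncomputable def crackDensity4 (ωm : ℝ) (ω' h : Matrix (Fin 3) (Fin 3) ℝ) (n : Fin 3 → ℝ) : ℝ :=
  ωm + n ⬝ᵥ ω'.mulVec n + (n ⬝ᵥ h.mulVec n) ^ 2
    - 4 / 7 * (∑ i, n i ^ 2) * (n ⬝ᵥ (h * h).mulVec n)
    + 2 / 35 * (h * h).trace * (∑ i, n i ^ 2) ^ 2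

/-- A multilinear form restricted to the diagonal of a plane is a homogeneous polynomial in the
two coordinates. -/
lemma MultilinearMap.exists_coeff_smul_add_smul {R M N : Type*} [CommSemiring R]
    [AddCommMonoid M] [Module R M] [AddCommMonoid N] [Module R N] {d : ℕ}
    (F : MultilinearMap R (fun _ : Fin d => M) N) (u v : M) :
    ∃ c : ℕ → N, ∀ x y : R,
      F (fun _ => x • u + y • v) = ∑ k ∈ Finset.range (d + 1), (x ^ k * y ^ (d - k)) • c k := by
  refine ⟨fun k => ∑ s : Finset (Fin d) with s.card = k,
    F (s.piecewise (fun _ => u) (fun _ => v)), fun x y => ?_⟩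
  have key (s : Finset (Fin d)) : F (s.piecewise (fun _ => x • u) (fun _ => y • v)) =
      (x ^ s.card * y ^ (d - s.card)) • F (s.piecewise (fun _ => u) (fun _ => v)) := by
    have h : s.piecewise (fun _ => x • u) (fun _ => y • v) =
        fun i => s.piecewise (fun _ => x) (fun _ => y) i •
          s.piecewise (fun _ => u) (fun _ => v) i := by
      funext i
      by_cases hi : i ∈ s <;> simp [hi]
    rw [h, F.map_smul_univ, Finset.prod_piecewise]
    simp [← Finset.compl_eq_univ_sdiff, Finset.card_compl]
  have hadd := F.map_add_univ (fun _ => x • u) (fun _ => y • v)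
  simp only [key] at hadd
  refine hadd.trans ?_
  rw [← Finset.sum_fiberwise_of_maps_to (g := Finset.card) (t := Finset.range (d + 1))
    (fun s _ => Finset.mem_range.2 (Nat.lt_succ_of_le (by simpa using s.card_le_univ)))]
  refine Finset.sum_congr rfl fun k _ => ?_
  rw [Finset.smul_sum]
  refine Finset.sum_congr rfl fun s hs => ?_
  rw [(Finset.mem_filter.1 hs).2]

/-- Square roots of complex numbers, in real coordinates. -/
lemma exists_sq_sub_sq_eq_and_two_mul_eq (a b : ℝ) :
    ∃ p q : ℝ, p ^ 2 - q ^ 2 = a ∧ 2 * p * q = b := by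
  obtain ⟨z, hz⟩ := IsAlgClosed.exists_pow_nat_eq (⟨a, b⟩ : ℂ) two_pos
  rw [sq, Complex.ext_iff, Complex.mul_re, Complex.mul_im] at hz
  exact ⟨z.re, z.im, by linear_combination hz.1, by linear_combination hz.2⟩

/-- **Theorem 1 (existence).** Any totally symmetric quadrilinear form `F` on ℝ³ is represented,
over the mechanically accessible directions `ℛ(ν) = {τ : ‖τ‖ = 1, τ·ν = 0} ∪ {ν}` with `ν = e₃`,
by a scalar `ω_m`, a traceless symmetric `ω′` with `ω′ν ∥ ν` (equivalently `ω′₁₃ = ω′₂₃ = 0`),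
and a traceless symmetric `h` with `hν = 0`, via
`F(n,n,n,n) = ω_m + nᵀω′n + (nᵀhn)² − (4/7)‖n‖²nᵀh²n + (2/35)tr(h²)‖n‖⁴`. -/
theorem theorem1_existence
    (F : MultilinearMap ℝ (fun _ : Fin 4 => (Fin 3 → ℝ)) ℝ)
    (hF : ∀ (σ : Equiv.Perm (Fin 4)) (v : Fin 4 → (Fin 3 → ℝ)), F (v ∘ σ) = F v) :
    ∃ (ωm : ℝ) (ω' h : Matrix (Fin 3) (Fin 3) ℝ),
      ω'.IsSymm ∧ ω'.trace = 0 ∧ ω' 0 2 = 0 ∧ ω' 1 2 = 0 ∧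
      h.IsSymm ∧ h.trace = 0 ∧ h.mulVec nu3 = 0 ∧
      ∀ n : Fin 3 → ℝ, ((∑ i, n i ^ 2 = 1 ∧ n ⬝ᵥ nu3 = 0) ∨ n = nu3) →
        F (fun _ => n) = crackDensity4 ωm ω' h n := by
  obtain ⟨c, hc⟩ := F.exists_coeff_smul_add_smul ![1, 0, 0] ![0, 1, 0]
  obtain ⟨p, q, hre, him⟩ := exists_sq_sub_sq_eq_and_two_mul_eq
    ((c 4 + c 0 - c 2) / 4) ((c 3 - c 1) / 4)
  -- `m` is the mean of `F` over the unit circle orthogonal to `ν`, less the harmonic square's mean.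
  set r := p ^ 2 + q ^ 2 with hr
  set m := 3 * (c 4 + c 0) / 8 + c 2 / 8 - r / 2 + 4 / 7 * r - 4 / 35 * r with hm
  set t := F (fun _ => nu3) - 4 / 35 * r with ht
  set w := 2 / 3 * (t - m) with hw
  refine ⟨t - w, !![-w / 2 + (c 4 - c 0) / 2, (c 3 + c 1) / 4, 0;
      (c 3 + c 1) / 4, -w / 2 - (c 4 - c 0) / 2, 0; 0, 0, w],
    !![p, q, 0; q, -p, 0; 0, 0, 0], ?_, ?_, rfl, rfl, ?_, ?_, ?_, ?_⟩
  · ext i j; fin_cases i <;> fin_cases j <;> rfl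
  · simp [Matrix.trace, Fin.sum_univ_three]
  · ext i j; fin_cases i <;> fin_cases j <;> rfl
  · simp [Matrix.trace, Fin.sum_univ_three]
  · ext i; fin_cases i <;> simp [nu3, Matrix.mulVec, dotProduct, Fin.sum_univ_three]
  rintro n (⟨hn, hn3⟩ | rfl)
  · have h2 : n 2 = 0 := by simpa [nu3, dotProduct, Fin.sum_univ_three] using hn3
    have hplane : n = n 0 • ![1, 0, 0] + n 1 • ![0, 1, 0] := by
      ext i; fin_cases i <;> simp [h2]
    have hF4 : F (fun _ => n) = _ :=
      (congrArg (fun v => F (fun _ => v)) hplane).trans (hc (n 0) (n 1))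
    rw [hF4]
    simp only [Fin.sum_univ_three, h2] at hn
    simp [Finset.sum_range_succ, crackDensity4, Matrix.mulVec, dotProduct, Matrix.trace,
      Matrix.mul_apply, Fin.sum_univ_three, h2]
    generalize n 0 = x at *
    generalize n 1 = y at *
    simp only [hw, hm, hr]
    linear_combination
      ((t - w) * (x ^ 2 + y ^ 2 + 1) + (-w / 2 * (x ^ 2 + y ^ 2) +
        (c 4 - c 0) / 2 * (x ^ 2 - y ^ 2) + (c 3 + c 1) / 2 * x * y)) * hn
      - ((x ^ 2 - y ^ 2) ^ 2 - (2 * x * y) ^ 2) / 2 * hre - (x ^ 2 - y ^ 2) * (2 * x * y) * him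
  · simp [crackDensity4, nu3, Matrix.mulVec, dotProduct, Matrix.trace, Matrix.mul_apply,
      Fin.sum_univ_three]
    simp only [ht, hr, nu3]
    ring
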